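/- Let n ≥ 1, let α = (α_0, …, α_n) ∈ ℝ^{n+1} have all coordinates strictly positive, and let r = (r_0, …, r_n) ∈ ℕ^{n+1}. Then for every x in the standard n-simplex Δ_n with all coordinates strictly positive, the Bayesian posterior density equals the Dirichlet density with updated parameter: (∏_{i=0}^n x_i^{r_i}) · b_n(x, α) / ∫_{Δ_n} (∏_{i=0}^n y_i^{r_i}) · b_n(y, α) dy = b_n(x, α + r) / B_n(α + r), where the integral over Δ_n is taken in the parametrization by the first n coordinates with respect to n-dimensional Lebesgue measure. In particular, the posterior distribution obtained from a Dirichlet(α) prior and a multinomial observation with counts r is the Dirichlet distribution with parameter α + r (conjugacy of the Dirichlet prior for the multinomial likelihood). -/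

import Mathlib

open MeasureTheory

/-- The corner simplex `T_n = {x ∈ ℝ^n : x_i ≥ 0, Σ x_i ≤ 1}` parametrizing the
standard `n`-simplex `Δ_n` by its first `n` coordinates. -/
def cornerSimplex (n : ℕ) : Set (Fin n → ℝ) :=
  {x | (∀ i, 0 ≤ x i) ∧ ∑ i, x i ≤ 1}

/-- Parametrization `T_n → Δ_n ⊆ ℝ^{n+1}`, `x ↦ (x_0,…,x_{n−1}, 1 − Σ_{i<n} x_i)`. -/
noncomputable def toSimplex {n : ℕ} (x : Fin n → ℝ) : Fin (n + 1) → ℝ :=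
  Fin.snoc x (1 - ∑ i, x i)

/-- `b_n(x, β) = ∏_{i=0}^n x_i^{β_i − 1}`. -/
noncomputable def bFun (n : ℕ) (x β : Fin (n + 1) → ℝ) : ℝ :=
  ∏ i, x i ^ (β i - 1)

/-- The multivariate beta function `B_n(β) = (∏_{i=0}^n Γ(β_i)) / Γ(Σ_{i=0}^n β_i)`. -/
noncomputable def multiBeta (n : ℕ) (β : Fin (n + 1) → ℝ) : ℝ :=
  (∏ i, Real.Gamma (β i)) / Real.Gamma (∑ i, β i)

/-- Truncated power, extended by zero to negative reals. -/
noncomputable def gPow (c t : ℝ) : ENNReal :=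
  ENNReal.ofReal (if 0 ≤ t then t ^ (c - 1) else 0)

lemma gPow_measurable (c : ℝ) : Measurable (gPow c) :=
  ENNReal.measurable_ofReal.comp
    (Measurable.ite measurableSet_Ici (by fun_prop) measurable_const)

lemma gPow_neg {c t : ℝ} (h : t < 0) : gPow c t = 0 := by
  simp [gPow, not_le.2 h]

lemma gPow_nonneg {c t : ℝ} (h : 0 ≤ t) : gPow c t = ENNReal.ofReal (t ^ (c - 1)) := by
  simp [gPow, h]

lemma gPow_conv {a b s : ℝ} (ha : 0 < a) (hb : 0 < b) (hs : s ≠ 0) :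
    ∫⁻ t, gPow a t * gPow b (s - t)
      = ENNReal.ofReal (ProbabilityTheory.beta a b) * gPow (a + b) s := by
  rcases lt_or_gt_of_ne hs with h | h
  · rw [gPow_neg h, mul_zero]
    refine (lintegral_congr fun t => ?_).trans lintegral_zero
    rcases lt_or_ge t 0 with ht | ht
    · simp [gPow_neg ht]
    · simp [gPow_neg (show s - t < 0 by linarith)]
  · have hm : Measurable fun t => gPow a t * gPow b (s - t) :=
      (gPow_measurable a).mul ((gPow_measurable b).comp (by fun_prop))
    rw [← Real.smul_map_volume_mul_left hs, lintegral_smul_measure,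
      lintegral_map hm (by fun_prop)]
    have hB := ProbabilityTheory.beta_pos ha hb
    have key : ∀ᵐ u : ℝ, gPow a (s * u) * gPow b (s - s * u)
        = ENNReal.ofReal (s ^ (a - 1) * s ^ (b - 1) * ProbabilityTheory.beta a b)
          * ProbabilityTheory.betaPDF a b u := by
      filter_upwards [Measure.ae_ne volume (0 : ℝ), Measure.ae_ne volume (1 : ℝ)] with u h0 h1
      rcases lt_or_gt_of_ne h0 with h0 | h0
      · rw [gPow_neg (by nlinarith), ProbabilityTheory.betaPDF_eq_zero_of_nonpos h0.le]; simp
      rcases lt_or_gt_of_ne h1 with h1 | h1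
      · rw [ProbabilityTheory.betaPDF_of_pos_lt_one h0 h1, gPow_nonneg (by positivity),
          gPow_nonneg (by nlinarith), ← ENNReal.ofReal_mul (by positivity),
          ← ENNReal.ofReal_mul (by positivity),
          show s - s * u = s * (1 - u) by ring, Real.mul_rpow h.le h0.le,
          Real.mul_rpow h.le (by linarith)]
        congr 1
        field_simp
      · rw [gPow_neg (c := b) (by nlinarith), ProbabilityTheory.betaPDF_eq_zero_of_one_le h1.le]
        simp
    rw [lintegral_congr_ae key, lintegral_const_mul' _ _ ENNReal.ofReal_ne_top,
      ProbabilityTheory.lintegral_betaPDF_eq_one ha hb, mul_one, abs_of_pos h, smul_eq_mul,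
      ← ENNReal.ofReal_mul h.le, gPow_nonneg h.le, ← ENNReal.ofReal_mul hB.le]
    congr 1
    rw [show a + b - 1 = 1 + (a - 1) + (b - 1) by ring, Real.rpow_add h, Real.rpow_add h,
      Real.rpow_one]
    ring

lemma multiBeta_pos (n : ℕ) (β : Fin (n + 1) → ℝ) (hβ : ∀ i, 0 < β i) : 0 < multiBeta n β :=
  div_pos (Finset.prod_pos fun i _ => Real.Gamma_pos_of_pos (hβ i))
    (Real.Gamma_pos_of_pos (Finset.sum_pos (fun i _ => hβ i) ⟨0, by simp⟩))

lemma dirichlet_lint (n : ℕ) : ∀ (β : Fin (n + 1) → ℝ) (_ : ∀ i, 0 < β i) (s : ℝ) (_ : s ≠ 0),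
    ∫⁻ y : Fin n → ℝ, (∏ i, gPow (β i.castSucc) (y i)) * gPow (β (Fin.last n)) (s - ∑ i, y i)
      = ENNReal.ofReal (multiBeta n β) * gPow (∑ i, β i) s := by
  induction n with
  | zero =>
    intro β hβ s hs
    have := (Real.Gamma_pos_of_pos (hβ 0)).ne'
    simp [multiBeta, div_self this, lintegral_unique, volume_pi, Measure.pi_of_empty]
  | succ n ih =>
    intro β hβ s hs
    have hm : Measurable fun p : ℝ × (Fin n → ℝ) =>
        gPow (β 0) p.1 * ((∏ i : Fin n, gPow (β i.succ.castSucc) (p.2 i)) *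
          gPow (β (Fin.last (n + 1))) (s - p.1 - ∑ i, p.2 i)) := by
      refine ((gPow_measurable _).comp measurable_fst).mul (Measurable.mul ?_ ?_)
      · exact Finset.measurable_prod _ fun i _ => (gPow_measurable _).comp (by fun_prop)
      · exact (gPow_measurable _).comp (by fun_prop)
    have hmp := volume_preserving_piFinSuccAbove (fun _ : Fin (n + 1) => ℝ) 0
    have h1 := hmp.lintegral_comp hm
    have hS : 0 < ∑ i : Fin (n + 1), β i.succ :=
      Finset.sum_pos (fun i _ => hβ _) ⟨0, by simp⟩
    calc _ = _ := by
          refine Eq.trans (lintegral_congr fun y => ?_) h1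
          simp [MeasurableEquiv.piFinSuccAbove, Fin.prod_univ_succ, Fin.sum_univ_succ, mul_assoc,
            Fin.tail, sub_sub]
      _ = ∫⁻ t, gPow (β 0) t * (ENNReal.ofReal (multiBeta n (fun i => β i.succ)) *
            gPow (∑ i : Fin (n + 1), β i.succ) (s - t)) := by
          rw [Measure.volume_eq_prod, lintegral_prod _ hm.aemeasurable]
          refine lintegral_congr_ae ?_
          filter_upwards [Measure.ae_ne volume s] with t ht
          rw [← ih (fun i => β i.succ) (fun i => hβ _) (s - t) (sub_ne_zero.2 ht.symm),
            ← lintegral_const_mul' _ _ (by exact ENNReal.ofReal_ne_top)]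
          simp
      _ = ENNReal.ofReal (multiBeta n (fun i => β i.succ)) *
            ∫⁻ t, gPow (β 0) t * gPow (∑ i : Fin (n + 1), β i.succ) (s - t) := by
          rw [← lintegral_const_mul' _ _ ENNReal.ofReal_ne_top]
          exact lintegral_congr fun t => by ring
      _ = _ := by
          rw [gPow_conv (hβ 0) hS hs, ← mul_assoc, ← ENNReal.ofReal_mul
            (multiBeta_pos n _ fun i => hβ _).le, ← Fin.sum_univ_succ β]
          congr 2
          have := (Real.Gamma_pos_of_pos hS).ne'
          rw [multiBeta, multiBeta, ProbabilityTheory.beta, ← Fin.sum_univ_succ β,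
            Fin.prod_univ_succ (fun i => Real.Gamma (β i))]
          field_simp

lemma toSimplex_nonneg {n : ℕ} {y : Fin n → ℝ} (hy : y ∈ cornerSimplex n) (i : Fin (n + 1)) :
    0 ≤ toSimplex y i := by
  refine Fin.lastCases ?_ (fun j => ?_) i
  · simpa [toSimplex] using hy.2
  · simpa [toSimplex] using hy.1 j

lemma cornerSimplex_measurable (n : ℕ) : MeasurableSet (cornerSimplex n) := by
  apply IsClosed.measurableSet
  have : cornerSimplex n = (⋂ i, {x : Fin n → ℝ | 0 ≤ x i}) ∩ {x | ∑ i, x i ≤ 1} := by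
    ext x; simp [cornerSimplex]
  rw [this]
  exact (isClosed_iInter fun i => isClosed_le (by fun_prop) (by fun_prop)).inter
    (isClosed_le (by fun_prop) (by fun_prop))

lemma dirichlet_integral (n : ℕ) (β : Fin (n + 1) → ℝ) (hβ : ∀ i, 0 < β i) :
    ∫ y in cornerSimplex n, bFun n (toSimplex y) β = multiBeta n β := by
  have hS := cornerSimplex_measurable n
  have hm : Measurable fun y : Fin n → ℝ => bFun n (toSimplex y) β := by
    simp only [bFun, Fin.prod_univ_castSucc, toSimplex, Fin.snoc_castSucc, Fin.snoc_last]
    fun_prop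
  rw [integral_eq_lintegral_of_nonneg_ae]
  · have := dirichlet_lint n β hβ 1 one_ne_zero
    rw [gPow_nonneg zero_le_one, Real.one_rpow, ENNReal.ofReal_one, mul_one] at this
    rw [← ENNReal.toReal_ofReal (multiBeta_pos n β hβ).le, ← this, ← lintegral_indicator hS]
    congr 1
    refine lintegral_congr fun y => ?_
    by_cases hy : y ∈ cornerSimplex n
    · rw [Set.indicator_of_mem hy, bFun, ENNReal.ofReal_prod_of_nonneg
        (fun i _ => Real.rpow_nonneg (toSimplex_nonneg hy i) _), Fin.prod_univ_castSucc]
      congr 1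
      · refine Finset.prod_congr rfl fun i _ => ?_
        rw [gPow_nonneg (hy.1 i)]; simp [toSimplex]
      · rw [gPow_nonneg (sub_nonneg.2 hy.2)]; simp [toSimplex]
    · rw [Set.indicator_of_notMem hy]
      by_cases h : ∀ i, 0 ≤ y i
      · have : 1 - ∑ i, y i < 0 := by
          by_contra h2
          exact hy ⟨h, by linarith⟩
        rw [gPow_neg this, mul_zero]
      · push Not at h
        obtain ⟨i, hi⟩ := h
        rw [Finset.prod_eq_zero (Finset.mem_univ i) (gPow_neg hi), zero_mul]
  · refine ae_restrict_of_forall_mem hS fun y hy => ?_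
    exact Finset.prod_nonneg fun i _ => Real.rpow_nonneg (toSimplex_nonneg hy i) _
  · exact hm.aestronglyMeasurable

lemma prod_mul_bFun (n : ℕ) (α : Fin (n + 1) → ℝ) (hα : ∀ i, 0 < α i) (r : Fin (n + 1) → ℕ)
    (x : Fin (n + 1) → ℝ) (hx : ∀ i, 0 ≤ x i) :
    (∏ i, x i ^ (r i : ℝ)) * bFun n x α = bFun n x (fun i => α i + (r i : ℝ)) := by
  rw [bFun, bFun, ← Finset.prod_mul_distrib]
  refine Finset.prod_congr rfl fun i _ => ?_
  rcases Nat.eq_zero_or_pos (r i) with h | h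
  · simp [h]
  · have h1 : (1 : ℝ) ≤ r i := by exact_mod_cast h
    rw [← Real.rpow_add' (hx i) (by linarith [hα i])]
    congr 1; ring

/-- **conjugacy of the Dirichlet prior for the multinomial likelihood.**
For `n ≥ 1`, `α ∈ ℝ^{n+1}` with all coordinates positive, counts `r ∈ ℕ^{n+1}` and any
`x ∈ Δ_n` with all coordinates positive, the Bayesian posterior density
`(∏ x_i^{r_i}) b_n(x,α) / ∫_{Δ_n} (∏ y_i^{r_i}) b_n(y,α) dy` equals the Dirichlet density
`b_n(x, α + r)/B_n(α + r)` with updated parameter `α + r`; the integral over `Δ_n` is taken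
in the parametrization by the first `n` coordinates with respect to Lebesgue measure. -/
theorem dirichlet_multinomial_conjugacy (n : ℕ) (hn : 1 ≤ n)
    (α : Fin (n + 1) → ℝ) (hα : ∀ i, 0 < α i) (r : Fin (n + 1) → ℕ)
    (x : Fin (n + 1) → ℝ) (hx : ∀ i, 0 < x i) (hx1 : ∑ i, x i = 1) :
    (∏ i, x i ^ (r i : ℝ)) * bFun n x α /
        ∫ y in cornerSimplex n,
          (∏ i, toSimplex y i ^ (r i : ℝ)) * bFun n (toSimplex y) α
      = bFun n x (fun i => α i + (r i : ℝ)) / multiBeta n (fun i => α i + (r i : ℝ)) := by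
  have hI : ∫ y in cornerSimplex n,
      (∏ i, toSimplex y i ^ (r i : ℝ)) * bFun n (toSimplex y) α
      = multiBeta n (fun i => α i + (r i : ℝ)) := by
    rw [← dirichlet_integral n _ (fun i => add_pos_of_pos_of_nonneg (hα i) (Nat.cast_nonneg _))]
    exact setIntegral_congr_fun (cornerSimplex_measurable n) fun y hy =>
      prod_mul_bFun n α hα r _ (toSimplex_nonneg hy)
  rw [hI, prod_mul_bFun n α hα r x (fun i => (hx i).le)]
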